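/- Suppose the binary expansion of n factors as β(n) = a c where a = 1^r is the principal prefix of β(n) and c contains at most one zero and exactly s ones (so either c is empty, or c = 0 1^s). Then in ℤ[q]: if c is empty (i.e., n = 2^r − 1), h_q(n) = q^r; and if c = 0 1^s, h_q(n) = q^{r+s} + q^{r+s+1} + ⋯ + q^{2r+s}. -/

import Mathlib

/-- A multiset of naturals is *hyperbinary* if every element is a power of `2`
and no element occurs more than twice. -/
def IsHyperbinary (μ : Multiset ℕ) : Prop :=
  (∀ x ∈ μ, ∃ i : ℕ, x = 2 ^ i) ∧ ∀ x : ℕ, μ.count x ≤ 2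

open scoped Classical in
/-- `hq n` is the length generating function `h_q(n) = Σ_{η ∈ H(n)} q^{ℓ(η)}`
over the hyperbinary partitions of `n`, as a polynomial in `ℤ[q]`. -/
noncomputable def hq (n : ℕ) : Polynomial ℤ :=
  ∑ p ∈ Finset.univ.filter (fun p : n.Partition => IsHyperbinary p.parts),
      (Polynomial.X : Polynomial ℤ) ^ (Multiset.card p.parts)

theorem IsHyperbinary.pos {μ : Multiset ℕ} (h : IsHyperbinary μ) {x : ℕ} (hx : x ∈ μ) :
    0 < x := by
  obtain ⟨i, rfl⟩ := h.1 x hx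
  positivity

theorem two_mul_injective : Function.Injective (fun x : ℕ => 2 * x) :=
  fun a b h => by simpa using h

theorem isHyperbinary_replicate_add_map {k : ℕ} {ν : Multiset ℕ} :
    IsHyperbinary (Multiset.replicate k 1 + ν.map (2 * ·)) ↔ k ≤ 2 ∧ IsHyperbinary ν := by
  have count_double (y : ℕ) :
      (Multiset.replicate k 1 + ν.map (2 * ·)).count (2 * y) = ν.count y := by
    rw [Multiset.count_add, Multiset.count_map_eq_count' _ _ two_mul_injective,
      Multiset.count_replicate, if_neg (by omega), zero_add]
  have count_odd {x : ℕ} (hx : x % 2 = 1) :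
      (Multiset.replicate k 1 + ν.map (2 * ·)).count x = if 1 = x then k else 0 := by
    rw [Multiset.count_add, Multiset.count_replicate, Multiset.count_eq_zero_of_notMem, add_zero]
    simp only [Multiset.mem_map, not_exists, not_and]
    omega
  constructor
  · intro h
    refine ⟨by simpa [count_odd] using h.2 1, fun x hx => ?_, fun x => count_double x ▸ h.2 _⟩
    have hmem : 2 * x ∈ Multiset.replicate k 1 + ν.map (2 * ·) :=
      Multiset.mem_add.2 (Or.inr (Multiset.mem_map_of_mem _ hx))
    obtain ⟨i, hi⟩ := h.1 _ hmem
    cases i with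
    | zero => omega
    | succ i => exact ⟨i, by rw [pow_succ] at hi; omega⟩
  · rintro ⟨hk, hν⟩
    refine ⟨fun x hx => ?_, fun x => ?_⟩
    · rcases Multiset.mem_add.1 hx with hx | hx
      · exact ⟨0, Multiset.eq_of_mem_replicate hx⟩
      · obtain ⟨y, hy, rfl⟩ := Multiset.mem_map.1 hx
        obtain ⟨i, rfl⟩ := hν.1 y hy
        exact ⟨i + 1, by ring⟩
    · rcases Nat.mod_two_eq_zero_or_one x with hx | hx
      · obtain ⟨y, rfl⟩ := Nat.dvd_of_mod_eq_zero hx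
        exact count_double y ▸ hν.2 y
      · rw [count_odd hx]
        split_ifs <;> omega

theorem IsHyperbinary.exists_eq_replicate_add_map {μ : Multiset ℕ} (h : IsHyperbinary μ) :
    ∃ k ν, μ = Multiset.replicate k 1 + ν.map (2 * ·) ∧ k ≤ 2 ∧ IsHyperbinary ν := by
  have key : μ = Multiset.replicate (μ.count 1) 1 +
      ((μ.filter (¬ · = 1)).map (· / 2)).map (2 * ·) := by
    rw [Multiset.map_map, Multiset.map_congr rfl (g := id), Multiset.map_id,
      ← Multiset.filter_eq', Multiset.filter_add_not]
    intro x hx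
    obtain ⟨hx, hne⟩ := Multiset.mem_filter.1 hx
    obtain ⟨i, rfl⟩ := h.1 x hx
    cases i with
    | zero => simp at hne
    | succ i => simp [pow_succ, mul_comm]
  exact ⟨_, _, key, isHyperbinary_replicate_add_map.1 (key ▸ h)⟩

open scoped Classical in
/-- The hyperbinary partitions of `n`, as a finset of multisets. -/
noncomputable def hyperbinaryPartitions (n : ℕ) : Finset (Multiset ℕ) :=
  (Finset.univ.filter fun p : n.Partition => IsHyperbinary p.parts).image Nat.Partition.parts

theorem mem_hyperbinaryPartitions {n : ℕ} {μ : Multiset ℕ} :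
    μ ∈ hyperbinaryPartitions n ↔ IsHyperbinary μ ∧ μ.sum = n := by
  simp only [hyperbinaryPartitions, Finset.mem_image, Finset.mem_filter, Finset.mem_univ,
    true_and]
  constructor
  · rintro ⟨p, hp, rfl⟩
    exact ⟨hp, p.parts_sum⟩
  · rintro ⟨hμ, hsum⟩
    exact ⟨⟨μ, hμ.pos, hsum⟩, hμ, rfl⟩

theorem hq_eq_sum_hyperbinaryPartitions (n : ℕ) :
    hq n = ∑ μ ∈ hyperbinaryPartitions n, (Polynomial.X : Polynomial ℤ) ^ Multiset.card μ := by
  rw [hyperbinaryPartitions, Finset.sum_image fun _ _ _ _ h => Nat.Partition.ext h, hq]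

theorem replicate_add_map_injective (k : ℕ) :
    Function.Injective fun ν : Multiset ℕ => Multiset.replicate k 1 + ν.map (2 * ·) :=
  (add_right_injective _).comp (Multiset.map_injective two_mul_injective)

theorem sum_image_replicate_add_map (k m : ℕ) :
    ∑ μ ∈ (hyperbinaryPartitions m).image
        (fun ν => Multiset.replicate k 1 + ν.map (2 * ·)),
      (Polynomial.X : Polynomial ℤ) ^ Multiset.card μ = Polynomial.X ^ k * hq m := by
  rw [Finset.sum_image (replicate_add_map_injective k).injOn, hq_eq_sum_hyperbinaryPartitions,
    Finset.mul_sum]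
  simp [pow_add]

theorem sum_replicate_add_map (k : ℕ) (ν : Multiset ℕ) :
    (Multiset.replicate k 1 + ν.map (2 * ·)).sum = k + 2 * ν.sum := by
  rw [Multiset.sum_add, Multiset.sum_map_mul_left, Multiset.map_id', Multiset.sum_replicate, smul_eq_mul, mul_one]

theorem hq_two_mul_add_one (m : ℕ) : hq (2 * m + 1) = Polynomial.X * hq m := by
  have : hyperbinaryPartitions (2 * m + 1) = (hyperbinaryPartitions m).image
      (fun ν => Multiset.replicate 1 1 + ν.map (2 * ·)) := by
    ext μ
    simp only [Finset.mem_image, mem_hyperbinaryPartitions]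
    constructor
    · rintro ⟨hμ, hsum⟩
      obtain ⟨k, ν, rfl, hk, hν⟩ := hμ.exists_eq_replicate_add_map
      rw [sum_replicate_add_map] at hsum
      obtain rfl : k = 1 := by omega
      exact ⟨ν, ⟨hν, by omega⟩, rfl⟩
    · rintro ⟨ν, ⟨hν, rfl⟩, rfl⟩
      exact ⟨isHyperbinary_replicate_add_map.2 ⟨by norm_num, hν⟩, by
        rw [sum_replicate_add_map, add_comm]⟩
  rw [hq_eq_sum_hyperbinaryPartitions, this, sum_image_replicate_add_map, pow_one]

theorem hq_two_mul_add_two (m : ℕ) :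
    hq (2 * m + 2) = hq (m + 1) + Polynomial.X ^ 2 * hq m := by
  have hunion : hyperbinaryPartitions (2 * m + 2) =
      (hyperbinaryPartitions (m + 1)).image
        (fun ν => Multiset.replicate 0 1 + ν.map (2 * ·)) ∪
      (hyperbinaryPartitions m).image
        (fun ν => Multiset.replicate 2 1 + ν.map (2 * ·)) := by
    ext μ
    simp only [Finset.mem_union, Finset.mem_image, mem_hyperbinaryPartitions]
    constructor
    · rintro ⟨hμ, hsum⟩
      obtain ⟨k, ν, rfl, hk, hν⟩ := hμ.exists_eq_replicate_add_map
      rw [sum_replicate_add_map] at hsum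
      obtain rfl | rfl : k = 0 ∨ k = 2 := by omega
      · exact Or.inl ⟨ν, ⟨hν, by omega⟩, rfl⟩
      · exact Or.inr ⟨ν, ⟨hν, by omega⟩, rfl⟩
    · rintro (⟨ν, ⟨hν, hsum⟩, rfl⟩ | ⟨ν, ⟨hν, hsum⟩, rfl⟩)
      all_goals
        refine ⟨isHyperbinary_replicate_add_map.2 ⟨by norm_num, hν⟩, ?_⟩
        rw [sum_replicate_add_map]
        omega
  have hdisj : Disjoint
      ((hyperbinaryPartitions (m + 1)).image
        (fun ν => Multiset.replicate 0 1 + ν.map (2 * ·)))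
      ((hyperbinaryPartitions m).image
        (fun ν => Multiset.replicate 2 1 + ν.map (2 * ·))) := by
    simp only [Finset.disjoint_left, Finset.mem_image]
    rintro _ ⟨ν, -, rfl⟩ ⟨ν', -, h⟩
    have hmem : 1 ∈ Multiset.replicate 0 1 + ν.map (2 * ·) := h ▸ by simp
    simp only [Multiset.replicate_zero, zero_add, Multiset.mem_map] at hmem
    omega
  rw [hq_eq_sum_hyperbinaryPartitions, hunion, Finset.sum_union hdisj,
    sum_image_replicate_add_map, sum_image_replicate_add_map, pow_zero, one_mul]

theorem hq_zero : hq 0 = 1 := by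
  have : hyperbinaryPartitions 0 = {0} := by
    ext μ
    rw [mem_hyperbinaryPartitions, Finset.mem_singleton]
    constructor
    · rintro ⟨hμ, hsum⟩
      refine Multiset.eq_zero_of_forall_notMem fun x hx => ?_
      exact (hμ.pos hx).ne' (Multiset.sum_eq_zero_iff.1 hsum x hx)
    · rintro rfl
      exact ⟨⟨by simp, by simp⟩, rfl⟩
  simp [hq_eq_sum_hyperbinaryPartitions, this]

theorem hq_two_pow_sub_one (r : ℕ) : hq (2 ^ r - 1) = Polynomial.X ^ r := by
  induction r with
  | zero => simpa using hq_zero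
  | succ r ih =>
    have : 2 ^ (r + 1) - 1 = 2 * (2 ^ r - 1) + 1 := by
      have := Nat.one_le_two_pow (n := r)
      rw [pow_succ]
      omega
    rw [this, hq_two_mul_add_one, ih, pow_succ']

theorem hq_two_pow_succ_sub_two (r : ℕ) :
    hq (2 ^ (r + 1) - 2) = ∑ i ∈ Finset.range (r + 1), Polynomial.X ^ (r + i) := by
  induction r with
  | zero => simpa using hq_zero
  | succ r ih =>
    have hr := Nat.one_le_two_pow (n := r)
    have hn : 2 ^ (r + 1 + 1) - 2 = 2 * (2 ^ (r + 1) - 2) + 2 := by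
      simp only [pow_succ]
      omega
    have hm : 2 ^ (r + 1) - 2 + 1 = 2 ^ (r + 1) - 1 := by
      simp only [pow_succ]
      omega
    rw [hn, hq_two_mul_add_two, hm, hq_two_pow_sub_one, ih, Finset.sum_range_succ' _ (r + 1),
      Finset.mul_sum, add_comm]
    congr 1
    exact Finset.sum_congr rfl fun i _ => by ring

theorem hq_two_pow_sub_two_pow_sub_one (r s : ℕ) (hr : 1 ≤ r) :
    hq (2 ^ (r + s + 1) - 2 ^ s - 1) =
      ∑ i ∈ Finset.range (r + 1), Polynomial.X ^ (r + s + i) := by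
  induction s with
  | zero => simpa [Nat.sub_sub] using hq_two_pow_succ_sub_two r
  | succ s ih =>
    have hn : 2 ^ (r + (s + 1) + 1) - 2 ^ (s + 1) - 1 =
        2 * (2 ^ (r + s + 1) - 2 ^ s - 1) + 1 := by
      have hs := Nat.one_le_two_pow (n := s)
      have hle : 2 ^ (s + 1) ≤ 2 ^ (r + s + 1) := Nat.pow_le_pow_right two_pos (by omega)
      rw [← add_assoc r s 1, pow_succ 2 (r + s + 1)]
      rw [pow_succ] at hle ⊢
      omega
    rw [hn, hq_two_mul_add_one, ih, Finset.mul_sum]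
    exact Finset.sum_congr rfl fun i _ => by ring

/-- Suppose `β(n) = a c` where `a = 1^r` is the principal prefix and `c` has at most
one zero and exactly `s` ones, so either `c` is empty (i.e. `n = 2^r - 1`) or
`c = 0 1^s` (i.e. `n = 2^{r+s+1} - 2^s - 1`). Then `h_q(n) = q^r` in the former case
and `h_q(n) = q^{r+s} + q^{r+s+1} + ⋯ + q^{2r+s}` in the latter. -/
theorem hq_boundary_cases (r s n : ℕ) :
    (n = 2 ^ r - 1 → hq n = (Polynomial.X : Polynomial ℤ) ^ r) ∧
    (1 ≤ r → n = 2 ^ (r + s + 1) - 2 ^ s - 1 →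
      hq n = ∑ i ∈ Finset.range (r + 1),
        (Polynomial.X : Polynomial ℤ) ^ (r + s + i)) := by
  exact ⟨fun h => h ▸ hq_two_pow_sub_one r, fun hr h => h ▸ hq_two_pow_sub_two_pow_sub_one r s hr⟩
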